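/- arXiv:1203.4278 — 3 statements merged into one kernel-verified Lean document; each statement's English description precedes it below -/
import Mathlib

section
/- With the twisted Moyal star product ⋆, the coordinate functions satisfy the twisted commutation relation [x¹, x²]_⋆(x) = iθ e⁻¹(x) = i(θ + θω₂x₂ − θω₁x₁) for every x ∈ ℝ²; i.e. [x^μ, x^ν]_⋆ = iΘ̃^{μν}(x) where Θ̃¹²(x) = θ e⁻¹(x). -/
/-- The determinant function `e⁻¹(x₁,x₂) = 1 + ω₂x₂ − ω₁x₁`. -/
noncomputable def einv (ω₁ ω₂ : ℝ) (x : ℝ × ℝ) : ℝ := 1 + ω₂ * x.2 - ω₁ * x.1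

/-- Partial derivative `∂₁` of a function `ℝ² → ℂ`. -/
noncomputable def pd1 (f : ℝ × ℝ → ℂ) : ℝ × ℝ → ℂ := fun x => fderiv ℝ f x (1, 0)

/-- Partial derivative `∂₂` of a function `ℝ² → ℂ`. -/
noncomputable def pd2 (f : ℝ × ℝ → ℂ) : ℝ × ℝ → ℂ := fun x => fderiv ℝ f x (0, 1)

/-- The twisted Moyal star product:
`(f ⋆ g)(x) = Σ_{n=0}^∞ (1/n!) (iθe⁻¹(x)/2)^n Σ_{k=0}^n (−1)^{n−k} C(n,k)
(∂₁^k∂₂^{n−k}f)(x) (∂₂^k∂₁^{n−k}g)(x)`. -/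
noncomputable def tstar (θ ω₁ ω₂ : ℝ) (f g : ℝ × ℝ → ℂ) : ℝ × ℝ → ℂ := fun x =>
  ∑' n : ℕ, (1 / (n.factorial : ℂ)) * (Complex.I * (θ : ℂ) * (einv ω₁ ω₂ x : ℂ) / 2) ^ n *
    ∑ k ∈ Finset.range (n + 1), (-1 : ℂ) ^ (n - k) * (n.choose k : ℂ) *
      (pd1^[k] (pd2^[n - k] f) x) * (pd2^[k] (pd1^[n - k] g) x)

/-- The star commutator `[f,g]_⋆ = f⋆g − g⋆f`. -/
noncomputable def starComm (θ ω₁ ω₂ : ℝ) (f g : ℝ × ℝ → ℂ) : ℝ × ℝ → ℂ :=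
  fun x => tstar θ ω₁ ω₂ f g x - tstar θ ω₁ ω₂ g f x

theorem pd1_const (c : ℂ) : pd1 (fun _ => c) = 0 := by
  funext x
  simp [pd1]

theorem pd2_const (c : ℂ) : pd2 (fun _ => c) = 0 := by
  funext x
  simp [pd2]

theorem pd1_iterate_zero (n : ℕ) : pd1^[n] 0 = 0 :=
  Function.iterate_fixed (pd1_const 0) n

theorem pd2_iterate_zero (n : ℕ) : pd2^[n] 0 = 0 :=
  Function.iterate_fixed (pd2_const 0) n

/-- Mixed partial derivatives of order at least two of an affine function vanish. -/
theorem pd1_iterate_pd2_iterate_eq_zero {f : ℝ × ℝ → ℂ} {a b : ℂ}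
    (h₁ : pd1 f = fun _ => a) (h₂ : pd2 f = fun _ => b) {j k : ℕ} (hjk : 2 ≤ j + k) :
    pd1^[j] (pd2^[k] f) = 0 := by
  match k with
  | 0 =>
    obtain ⟨j, rfl⟩ := Nat.exists_eq_add_of_le' (show 2 ≤ j by omega)
    simp [Function.iterate_succ_apply, h₁, pd1_const, pd1_iterate_zero]
  | 1 =>
    obtain ⟨j, rfl⟩ := Nat.exists_eq_add_of_le' (show 1 ≤ j by omega)
    simp [Function.iterate_succ_apply, h₂, pd1_const, pd1_iterate_zero]
  | k + 2 =>
    simp [Function.iterate_succ_apply, h₂, pd2_const, pd2_iterate_zero, pd1_iterate_zero]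

/-- The star product with an affine left factor stops at first order. -/
theorem tstar_eq_of_pd_eq_const (θ ω₁ ω₂ : ℝ) {f : ℝ × ℝ → ℂ} {a b : ℂ}
    (h₁ : pd1 f = fun _ => a) (h₂ : pd2 f = fun _ => b) (g : ℝ × ℝ → ℂ) (x : ℝ × ℝ) :
    tstar θ ω₁ ω₂ f g x = f x * g x +
      Complex.I * (θ : ℂ) * (einv ω₁ ω₂ x : ℂ) / 2 * (a * pd2 g x - b * pd1 g x) := by
  unfold tstar
  rw [tsum_eq_sum (s := Finset.range 2)]
  · simp [Finset.sum_range_succ, h₁, h₂, -add_right_inj, -mul_eq_mul_left_iff]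
    ring
  · intro n hn
    have hn2 : 2 ≤ n := not_lt.mp (Finset.mem_range.not.mp hn)
    rw [Finset.sum_eq_zero, mul_zero]
    intro k hk
    have hk' : k < n + 1 := Finset.mem_range.mp hk
    rw [pd1_iterate_pd2_iterate_eq_zero h₁ h₂ (by omega)]
    simp

theorem hasFDerivAt_fst_ofReal (x : ℝ × ℝ) :
    HasFDerivAt (fun y : ℝ × ℝ => (y.1 : ℂ))
      (Complex.ofRealCLM.comp (ContinuousLinearMap.fst ℝ ℝ ℝ)) x :=
  (Complex.ofRealCLM.comp (ContinuousLinearMap.fst ℝ ℝ ℝ)).hasFDerivAt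

theorem hasFDerivAt_snd_ofReal (x : ℝ × ℝ) :
    HasFDerivAt (fun y : ℝ × ℝ => (y.2 : ℂ))
      (Complex.ofRealCLM.comp (ContinuousLinearMap.snd ℝ ℝ ℝ)) x :=
  (Complex.ofRealCLM.comp (ContinuousLinearMap.snd ℝ ℝ ℝ)).hasFDerivAt

theorem pd1_fst : pd1 (fun y => (y.1 : ℂ)) = fun _ => 1 := by
  funext x
  simp [pd1, (hasFDerivAt_fst_ofReal x).fderiv]

theorem pd2_fst : pd2 (fun y => (y.1 : ℂ)) = fun _ => 0 := by
  funext x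
  simp [pd2, (hasFDerivAt_fst_ofReal x).fderiv]

theorem pd1_snd : pd1 (fun y => (y.2 : ℂ)) = fun _ => 0 := by
  funext x
  simp [pd1, (hasFDerivAt_snd_ofReal x).fderiv]

theorem pd2_snd : pd2 (fun y => (y.2 : ℂ)) = fun _ => 1 := by
  funext x
  simp [pd2, (hasFDerivAt_snd_ofReal x).fderiv]

/-- The twisted commutation relation of the coordinate functions:
`[x¹, x²]_⋆(x) = iθ e⁻¹(x) = i(θ + θω₂x₂ − θω₁x₁)` for every `x ∈ ℝ²`. -/
theorem starComm_coord_coord (θ ω₁ ω₂ : ℝ) :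
    ∀ x : ℝ × ℝ,
      starComm θ ω₁ ω₂ (fun y => (y.1 : ℂ)) (fun y => (y.2 : ℂ)) x
        = Complex.I * (θ : ℂ) * (einv ω₁ ω₂ x : ℂ)
      ∧ Complex.I * (θ : ℂ) * (einv ω₁ ω₂ x : ℂ)
        = Complex.I * ((θ : ℂ) + (θ : ℂ) * (ω₂ : ℂ) * (x.2 : ℂ)
            - (θ : ℂ) * (ω₁ : ℂ) * (x.1 : ℂ)) := by
  intro x
  constructor
  · rw [starComm, tstar_eq_of_pd_eq_const θ ω₁ ω₂ pd1_fst pd2_fst,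
      tstar_eq_of_pd_eq_const θ ω₁ ω₂ pd1_snd pd2_snd, pd1_fst, pd2_fst, pd1_snd, pd2_snd]
    ring
  · push_cast [einv]
    ring
end

section
/- Let a ∈ ℂ and let b ∈ ℂ not be zero or a negative integer. The confluent hypergeometric function f₁(z) = Φ(a,b;z) satisfies Kummer's confluent hypergeometric differential equation z f''(z) + (b − z) f'(z) − a f(z) = 0 for every z ∈ ℂ (derivatives in the complex sense). -/
/-- The confluent hypergeometric (Kummer) function
`Φ(a,b;z) = Σ_{k=0}^∞ ((a)_k/((b)_k k!)) z^k`, where `(λ)_k` is the Pochhammer symbol. -/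
noncomputable def Phi (a b z : ℂ) : ℂ :=
  ∑' k : ℕ, (Polynomial.eval a (ascPochhammer ℂ k)) /
      ((Polynomial.eval b (ascPochhammer ℂ k)) * (k.factorial : ℂ)) * z ^ k

/-- If an everywhere convergent power series is differentiated termwise, the result
converges everywhere. -/
theorem summable_deriv_powerSeries {c : ℕ → ℂ} (hc : ∀ z, Summable fun k => c k * z ^ k) (z : ℂ) :
    Summable fun k : ℕ => ((k : ℂ) + 1) * c (k + 1) * z ^ k := by
  have hR : 1 ≤ ‖z‖ + 1 := by linarith [norm_nonneg z]
  have hs := (summable_nat_add_iff 1).2 (hc (2 * (‖z‖ + 1 : ℝ))).norm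
  refine Summable.of_norm_bounded hs fun k => ?_
  have hk : (k : ℝ) + 1 ≤ 2 ^ (k + 1) := by
    exact_mod_cast (Nat.lt_two_pow_self (n := k + 1)).le
  have hz : ‖z‖ ^ k ≤ (‖z‖ + 1) ^ (k + 1) :=
    (pow_le_pow_left₀ (norm_nonneg z) (by linarith) k).trans
      (pow_le_pow_right₀ hR (Nat.le_succ k))
  have hn : ‖(k : ℂ) + 1‖ = (k : ℝ) + 1 := by
    exact_mod_cast Complex.norm_natCast (k + 1)
  have hr : ‖(2 * ((‖z‖ + 1 : ℝ) : ℂ))‖ = 2 * (‖z‖ + 1) := by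
    rw [norm_mul, Complex.norm_real, Real.norm_of_nonneg (by positivity)]; simp
  rw [norm_mul, norm_mul, norm_mul, norm_pow, norm_pow, hn, hr, mul_pow]
  calc ((k : ℝ) + 1) * ‖c (k + 1)‖ * ‖z‖ ^ k
      = ‖c (k + 1)‖ * (((k : ℝ) + 1) * ‖z‖ ^ k) := by ring
    _ ≤ ‖c (k + 1)‖ * (2 ^ (k + 1) * (‖z‖ + 1) ^ (k + 1)) := by gcongr

/-- An everywhere convergent power series may be differentiated termwise. -/
theorem hasDerivAt_tsum_powerSeries {c : ℕ → ℂ} (hc : ∀ z, Summable fun k => c k * z ^ k) (z : ℂ) :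
    HasDerivAt (fun w => ∑' k, c k * w ^ k) (∑' k : ℕ, ((k : ℂ) + 1) * c (k + 1) * z ^ k) z := by
  set R : ℝ := ‖z‖ + 1 with hR
  have hR0 : 0 < R := by positivity
  have hRn : ‖(R : ℂ)‖ = R := by rw [Complex.norm_real, Real.norm_of_nonneg hR0.le]
  have hu : Summable fun k : ℕ => ‖c k * (k * (R : ℂ) ^ (k - 1))‖ := by
    refine Summable.norm ((summable_nat_add_iff 1).1 ?_)
    refine (summable_deriv_powerSeries hc (R : ℂ)).congr fun k => ?_
    push_cast
    ring
  have hz : z ∈ Metric.ball (0 : ℂ) R := by simp [hR]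
  have key := hasDerivAt_tsum_of_isPreconnected (g := fun k w => c k * w ^ k)
    (g' := fun k w => c k * (k * w ^ (k - 1))) hu Metric.isOpen_ball
    (convex_ball (0 : ℂ) R).isPreconnected
    (fun k w _ => (hasDerivAt_pow k w).const_mul (c k))
    (fun k w hw => by
      have hw' : ‖w‖ ≤ R := (mem_ball_zero_iff.1 hw).le
      simp only [norm_mul, norm_pow, hRn]
      gcongr)
    hz (hc z) hz
  have hs : Summable fun k : ℕ => c k * (k * z ^ (k - 1)) := by
    refine (summable_nat_add_iff 1).1 ((summable_deriv_powerSeries hc z).congr fun k => ?_)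
    push_cast
    ring
  rw [hs.tsum_eq_zero_add] at key
  simp only [Nat.cast_zero, zero_mul, mul_zero, zero_add, Nat.cast_add, Nat.cast_one,
    Nat.add_sub_cancel] at key
  simpa only [mul_comm, mul_left_comm, mul_assoc] using key

theorem ascPochhammer_eval_ne_zero {b : ℂ} (hb : ∀ n : ℕ, b ≠ -(n : ℂ)) (k : ℕ) :
    Polynomial.eval b (ascPochhammer ℂ k) ≠ 0 := by
  rw [Ne, ascPochhammer_eval_eq_zero_iff]
  rintro ⟨n, -, hn⟩
  exact hb n (by rw [hn, neg_neg])

/-- The `k`-th Taylor coefficient at `0` of the Kummer function `Phi a b`. -/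
noncomputable def kummerCoeff (a b : ℂ) (k : ℕ) : ℂ :=
  Polynomial.eval a (ascPochhammer ℂ k) / (Polynomial.eval b (ascPochhammer ℂ k) * (k.factorial : ℂ))

theorem kummerCoeff_succ (a : ℂ) {b : ℂ} (hb : ∀ n : ℕ, b ≠ -(n : ℂ)) (k : ℕ) :
    (b + k) * ((k : ℂ) + 1) * kummerCoeff a b (k + 1) = (a + k) * kummerCoeff a b k := by
  have h1 := ascPochhammer_eval_ne_zero hb k
  have h2 : b + k ≠ 0 := fun h => hb k (eq_neg_of_add_eq_zero_left h)
  have h3 : (k.factorial : ℂ) ≠ 0 := Nat.cast_ne_zero.2 k.factorial_ne_zero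
  have h4 : (k : ℂ) + 1 ≠ 0 := Nat.cast_add_one_ne_zero k
  simp only [kummerCoeff, ascPochhammer_succ_eval, Nat.factorial_succ]
  push_cast
  field_simp

theorem summable_kummerCoeff (a : ℂ) {b : ℂ} (hb : ∀ n : ℕ, b ≠ -(n : ℂ)) (z : ℂ) :
    Summable fun k => kummerCoeff a b k * z ^ k := by
  refine summable_of_ratio_norm_eventually_le (r := 1 / 2) (by norm_num) ?_
  filter_upwards [Filter.eventually_ge_atTop (⌈‖a‖ + 2 * ‖b‖ + 8 * ‖z‖ + 1⌉₊)] with k hk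
  have hk' : ‖a‖ + 2 * ‖b‖ + 8 * ‖z‖ + 1 ≤ k := Nat.ceil_le.1 hk
  have ha0 := norm_nonneg a
  have hb0 := norm_nonneg b
  have hz0 := norm_nonneg z
  have hkn : ‖(k : ℂ)‖ = k := Complex.norm_natCast k
  have hk1 : ‖(k : ℂ) + 1‖ = (k : ℝ) + 1 := by exact_mod_cast Complex.norm_natCast (k + 1)
  have ha : ‖a + k‖ ≤ 2 * k := by linarith [norm_add_le a (k : ℂ)]
  have hbk : (k : ℝ) / 2 ≤ ‖b + k‖ := by
    have := norm_sub_le (b + k) b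
    rw [add_sub_cancel_left] at this
    linarith
  have hrec := congrArg norm (kummerCoeff_succ a hb k)
  simp only [norm_mul, hk1] at hrec
  have hpos : 0 < ‖b + k‖ * ((k : ℝ) + 1) := by
    have : 0 < ‖b + k‖ := by linarith
    positivity
  have hratio : ‖a + k‖ * ‖z‖ ≤ 1 / 2 * (‖b + k‖ * ((k : ℝ) + 1)) :=
    calc ‖a + k‖ * ‖z‖ ≤ 2 * k * (k / 8) := by gcongr; linarith
      _ ≤ 1 / 2 * (k / 2 * ((k : ℝ) + 1)) := by nlinarith [Nat.cast_nonneg (α := ℝ) k]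
      _ ≤ _ := by gcongr
  simp only [norm_mul, norm_pow, pow_succ]
  refine le_of_mul_le_mul_left ?_ hpos
  calc ‖b + k‖ * ((k : ℝ) + 1) * (‖kummerCoeff a b (k + 1)‖ * (‖z‖ ^ k * ‖z‖))
      = ‖b + k‖ * ((k : ℝ) + 1) * ‖kummerCoeff a b (k + 1)‖ * (‖z‖ ^ k * ‖z‖) := by ring
    _ = ‖a + k‖ * ‖z‖ * (‖kummerCoeff a b k‖ * ‖z‖ ^ k) := by rw [hrec]; ring
    _ ≤ 1 / 2 * (‖b + k‖ * ((k : ℝ) + 1)) * (‖kummerCoeff a b k‖ * ‖z‖ ^ k) := by gcongr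
    _ = _ := by ring

/-- Multiplying the termwise derivative of a power series by the variable. -/
theorem hasSum_mul_deriv_powerSeries {c : ℕ → ℂ} (hc : ∀ z, Summable fun k => c k * z ^ k)
    (z : ℂ) :
    HasSum (fun k : ℕ => k * c k * z ^ k)
      (z * ∑' k : ℕ, ((k : ℂ) + 1) * c (k + 1) * z ^ k) := by
  rw [← hasSum_nat_add_iff' 1]
  have h := (summable_deriv_powerSeries hc z).hasSum.mul_left z
  simp only [Finset.range_one, Finset.sum_singleton, Nat.cast_zero, zero_mul, sub_zero]
  refine h.congr_fun fun k => ?_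
  push_cast
  ring

/-- For `b` not zero or a negative integer, `f₁(z) = Φ(a,b;z)` satisfies Kummer's
confluent hypergeometric differential equation
`z f₁''(z) + (b − z) f₁'(z) − a f₁(z) = 0` for every `z ∈ ℂ`. -/
theorem kummer_equation_Phi (a b : ℂ) (hb : ∀ n : ℕ, b ≠ -(n : ℂ)) :
    ∀ z : ℂ, z * deriv (deriv (Phi a b)) z + (b - z) * deriv (Phi a b) z - a * Phi a b z = 0 := by
  intro z
  have hc := summable_kummerCoeff a hb
  have hd := summable_deriv_powerSeries hc
  have h1 : deriv (Phi a b) =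
      fun w => ∑' k : ℕ, ((k : ℂ) + 1) * kummerCoeff a b (k + 1) * w ^ k :=
    funext fun w => (hasDerivAt_tsum_powerSeries hc w).deriv
  rw [h1, (hasDerivAt_tsum_powerSeries hd z).deriv]
  have hsum := (((hasSum_mul_deriv_powerSeries hd z).add ((hd z).hasSum.mul_left b)).sub
    (hasSum_mul_deriv_powerSeries hc z)).sub ((hc z).hasSum.mul_left a)
  have hzero := hsum.unique (hasSum_zero.congr_fun fun k => by
    linear_combination z ^ k * kummerCoeff_succ a hb k)
  change _ - a * ∑' k, kummerCoeff a b k * z ^ k = 0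
  linear_combination hzero
end

section
/- Let θ > 0 and let E, k be real numbers, and let n be a nonnegative integer. Consider the two linear equations in (u, v, w) ∈ ℝ³: (i) ((n+2)² − k²) u + (8E/θ²) v − (4/θ²) w = 0 and (ii) −(n+2) u + (16E/θ²) v − (8/θ²) w = 0 (these are the two recurrence relations ((n+2)²−k²)a_{n+2} + (8E/θ²)a_n − (4/θ²)a_{n−2} = 0 and −(n+2)a_{n+2} + (16E/θ²)a_n − (8/θ²)a_{n−2} = 0 from the twisted oscillator problem). Then equations (i) and (ii) have the same solution set if and only if 2k² = (n+2)(2n+5), i.e. k = ± √((n+2)(2n+5)/2). -/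
/-- The two three-term recurrence relations of the twisted oscillator problem, viewed as
linear equations `(i) ((n+2)² − k²)u + (8E/θ²)v − (4/θ²)w = 0` and
`(ii) −(n+2)u + (16E/θ²)v − (8/θ²)w = 0` in `(u,v,w) ∈ ℝ³`, have the same solution set
if and only if `2k² = (n+2)(2n+5)`, i.e. `k = ±√((n+2)(2n+5)/2)`. -/
theorem twisted_recurrences_compatible (θ E k : ℝ) (hθ : 0 < θ) (n : ℕ) :
    ({p : ℝ × ℝ × ℝ |
        (((n : ℝ) + 2) ^ 2 - k ^ 2) * p.1 + (8 * E / θ ^ 2) * p.2.1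
          - (4 / θ ^ 2) * p.2.2 = 0}
      = {p : ℝ × ℝ × ℝ |
        -((n : ℝ) + 2) * p.1 + (16 * E / θ ^ 2) * p.2.1 - (8 / θ ^ 2) * p.2.2 = 0})
      ↔ 2 * k ^ 2 = ((n : ℝ) + 2) * (2 * (n : ℝ) + 5) := by
  constructor
  · intro h
    have hp := Set.ext_iff.mp h (1, 0, (((n : ℝ) + 2) ^ 2 - k ^ 2) * θ ^ 2 / 4)
    simp only [Set.mem_ofPred_eq] at hp
    have h2 := hp.mp (by field_simp; ring)
    field_simp at h2
    exact mul_left_cancel₀ (pow_ne_zero 2 hθ.ne') (by linear_combination h2 / 4)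
  · intro h
    ext ⟨u, v, w⟩
    simp only [Set.mem_ofPred_eq]
    have double : -((n : ℝ) + 2) * u + (16 * E / θ ^ 2) * v - (8 / θ ^ 2) * w
        = 2 * ((((n : ℝ) + 2) ^ 2 - k ^ 2) * u + (8 * E / θ ^ 2) * v - (4 / θ ^ 2) * w) := by
      linear_combination u * h
    rw [double, mul_eq_zero_iff_left two_ne_zero]
end
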